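/- For all x, y ∈ {0,1}³: if |x| ≢ |y| (mod 3), then ⟨ψ(x), ψ(y)⟩ = 0; ⟨ψ(x), ψ(x)⟩ = 1; ψ(000) = ψ(111); and if x ≠ y, |x| ≡ |y| (mod 3), and |x|, |y| ∈ {1, 2}, then ⟨ψ(x), ψ(y)⟩ = −1/2. -/

import Mathlib

open Matrix

noncomputable section

/-- `ω = e^{2πi/3}`, a primitive cube root of unity. -/
def ω : ℂ := Complex.exp (2 * Real.pi * Complex.I / 3)

/-- The 3×3 quantum Fourier transform acting on the first three of five
basis states, and as the identity on the last two. -/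
def QFT : Matrix (Fin 5) (Fin 5) ℂ :=
  ((Real.sqrt 3 : ℂ))⁻¹ •
    !![1, 1, 1, 0, 0;
       1, ω, ω ^ 2, 0, 0;
       1, ω ^ 2, ω, 0, 0;
       0, 0, 0, (Real.sqrt 3 : ℂ), 0;
       0, 0, 0, 0, (Real.sqrt 3 : ℂ)]

/-- The first non-query unitary of the mod-3 algorithm. -/
def U : Matrix (Fin 5) (Fin 5) ℂ :=
  (1 / 4 : ℂ) •
    !![4, 0, 0, 0, 0;
       0, -(1/2) + Complex.I * (3 * (Real.sqrt 3 : ℂ) / 2), 0, 3, 0;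
       0, 0, -(1/2) - Complex.I * (3 * (Real.sqrt 3 : ℂ) / 2), 0, 3;
       0, 3, 0, (1/2) + Complex.I * (3 * (Real.sqrt 3 : ℂ) / 2), 0;
       0, 0, 3, 0, (1/2) - Complex.I * (3 * (Real.sqrt 3 : ℂ) / 2)]

/-- The second non-query unitary of the mod-3 algorithm. -/
def V : Matrix (Fin 5) (Fin 5) ℂ :=
  ((Real.sqrt 2 : ℂ))⁻¹ •
    !![(Real.sqrt 2 : ℂ), 0, 0, 0, 0;
       0, (1/2) - Complex.I * ((Real.sqrt 3 : ℂ) / 2), 0, 1, 0;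
       0, 0, (1/2) + Complex.I * ((Real.sqrt 3 : ℂ) / 2), 0, 1;
       0, 1, 0, -(1/2) - Complex.I * ((Real.sqrt 3 : ℂ) / 2), 0;
       0, 0, 1, 0, -(1/2) + Complex.I * ((Real.sqrt 3 : ℂ) / 2)]

/-- The phase oracle for a 3-bit input, acting trivially on the last two
dimensions: `O_x = diag((-1)^{x₁}, (-1)^{x₂}, (-1)^{x₃}, 1, 1)`. -/
def Ox (x : Fin 3 → Bool) : Matrix (Fin 5) (Fin 5) ℂ :=
  !![(if x 0 then -1 else 1 : ℂ), 0, 0, 0, 0;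
     0, (if x 1 then -1 else 1 : ℂ), 0, 0, 0;
     0, 0, (if x 2 then -1 else 1 : ℂ), 0, 0;
     0, 0, 0, 1, 0;
     0, 0, 0, 0, 1]

/-- The final state of the 2-query mod-3 algorithm:
`|ψ(x)⟩ = V (QFT† O_x QFT) U (QFT† O_x QFT) e₀`. -/
def ψ (x : Fin 3 → Bool) : Fin 5 → ℂ :=
  (V * (QFTᴴ * Ox x * QFT) * U * (QFTᴴ * Ox x * QFT)).mulVec
    (Pi.single (0 : Fin 5) (1 : ℂ))

/-- Hamming weight of a Boolean string. -/
def hamWt {n : ℕ} (x : Fin n → Bool) : ℕ :=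
  (Finset.univ.filter (fun i => x i = true)).card

end

theorem omega_eq : ω = -(1 / 2) + Complex.I * ((Real.sqrt 3 : ℂ) / 2) := by
  have h : (2 * Real.pi * Complex.I / 3 : ℂ) = ((Real.pi - Real.pi / 3 : ℝ) : ℂ) * Complex.I := by
    push_cast; ring
  rw [ω, h, Complex.exp_mul_I, ← Complex.ofReal_cos, ← Complex.ofReal_sin, Real.cos_pi_sub,
    Real.sin_pi_sub, Real.cos_pi_div_three, Real.sin_pi_div_three]
  push_cast; ring

theorem ofReal_sqrt_sq {r : ℝ} (hr : 0 ≤ r) : (Real.sqrt r : ℂ) ^ 2 = r := by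
  exact_mod_cast congrArg ((↑) : ℝ → ℂ) (Real.sq_sqrt hr)

theorem I_mul_sqrt_three : Complex.I * (Real.sqrt 3 : ℂ) = 1 + 2 * ω := by
  rw [omega_eq]; ring

theorem omega_sq : ω ^ 2 = -1 - ω := by
  have h := ofReal_sqrt_sq (r := 3) (by norm_num)
  push_cast at h
  rw [omega_eq]
  linear_combination (Complex.I ^ 2 / 4) * h + (3 / 4) * Complex.I_sq

theorem conj_omega : (starRingEnd ℂ) ω = -1 - ω := by
  simp only [omega_eq, map_add, map_neg, map_mul, map_div₀, map_one, map_ofNat, Complex.conj_I,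
    Complex.conj_ofReal]
  ring

/-- The operator of a single query, conjugated by the Fourier transform, for the phases
`a`, `b`, `c`. It is a circulant matrix on the first three coordinates. -/
noncomputable def queryMatrix (a b c : ℂ) : Matrix (Fin 5) (Fin 5) ℂ :=
  let t₀ := (a + b + c) / 3
  let t₁ := (a + b * ω + c * (-1 - ω)) / 3
  let t₂ := (a + b * (-1 - ω) + c * ω) / 3
  !![t₀, t₁, t₂, 0, 0;
     t₂, t₀, t₁, 0, 0;
     t₁, t₂, t₀, 0, 0;
     0, 0, 0, 1, 0;
     0, 0, 0, 0, 1]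

theorem conj_QFT_Ox (x : Fin 3 → Bool) :
    QFTᴴ * Ox x * QFT = queryMatrix (if x 0 then -1 else 1) (if x 1 then -1 else 1)
      (if x 2 then -1 else 1) := by
  have hs : (Real.sqrt 3 : ℂ) ≠ 0 := by simp
  have hs2 : (Real.sqrt 3 : ℂ)⁻¹ ^ 2 = 1 / 3 := by
    rw [inv_pow, ofReal_sqrt_sq (by norm_num)]; norm_num
  have hw := omega_sq
  rw [QFT, Ox, queryMatrix, omega_sq]
  generalize (if x 0 then -1 else 1 : ℂ) = a
  generalize (if x 1 then -1 else 1 : ℂ) = b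
  generalize (if x 2 then -1 else 1 : ℂ) = c
  ext i j
  fin_cases i <;> fin_cases j <;>
    simp [Matrix.mul_apply, Fin.sum_univ_five, conj_omega, hs] <;>
    generalize (Real.sqrt 3 : ℂ)⁻¹ = q at hs2 <;> grind

theorem U_eq : U = !![1, 0, 0, 0, 0;
    0, (1 + 3 * ω) / 4, 0, 3 / 4, 0;
    0, 0, (-2 - 3 * ω) / 4, 0, 3 / 4;
    0, 3 / 4, 0, (2 + 3 * ω) / 4, 0;
    0, 0, 3 / 4, 0, (-1 - 3 * ω) / 4] := by
  have h := I_mul_sqrt_three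
  rw [U]
  ext i j
  fin_cases i <;> fin_cases j <;> simp <;> grind

theorem V_eq : V = !![1, 0, 0, 0, 0;
    0, (Real.sqrt 2 : ℂ)⁻¹ * -ω, 0, (Real.sqrt 2 : ℂ)⁻¹, 0;
    0, 0, (Real.sqrt 2 : ℂ)⁻¹ * (1 + ω), 0, (Real.sqrt 2 : ℂ)⁻¹;
    0, (Real.sqrt 2 : ℂ)⁻¹, 0, (Real.sqrt 2 : ℂ)⁻¹ * (-1 - ω), 0;
    0, 0, (Real.sqrt 2 : ℂ)⁻¹, 0, (Real.sqrt 2 : ℂ)⁻¹ * ω] := by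
  have h := I_mul_sqrt_three
  rw [V]
  ext i j
  fin_cases i <;> fin_cases j <;> simp <;> grind

/-- The final states of the algorithm, up to a scaling of the last four coordinates by `√2`. -/
noncomputable def finalState : Bool → Bool → Bool → Fin 5 → ℂ
  | false, false, false => ![1, 0, 0, 0, 0]
  | false, false, true => ![0, -ω, 1 + ω, 0, 0]
  | false, true, false => ![0, 1 + ω, -ω, 0, 0]
  | true, false, false => ![0, -1, -1, 0, 0]
  | false, true, true => ![0, 0, 0, -1 - ω, ω]
  | true, false, true => ![0, 0, 0, ω, -1 - ω]
  | true, true, false => ![0, 0, 0, 1, 1]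
  | true, true, true => ![1, 0, 0, 0, 0]

theorem ψ_apply (x : Fin 3 → Bool) (j : Fin 5) :
    ψ x j = (if j = 0 then 1 else (Real.sqrt 2 : ℂ)⁻¹) * finalState (x 0) (x 1) (x 2) j := by
  have hw := omega_sq
  rw [ψ, conj_QFT_Ox, U_eq, V_eq]
  generalize (Real.sqrt 2 : ℂ)⁻¹ = r
  simp only [← Matrix.mulVec_mulVec]
  rw [Matrix.mulVec_single_one]
  simp only [queryMatrix, Matrix.mulVec, dotProduct, Fin.sum_univ_five]
  fin_cases j <;>
    simp <;>
    cases x 0 <;> cases x 1 <;> cases x 2 <;> simp [finalState] <;> grind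

theorem sum_conj_ψ_mul_ψ (x y : Fin 3 → Bool) :
    ∑ j : Fin 5, (starRingEnd ℂ) (ψ x j) * ψ y j =
      if hamWt x % 3 ≠ hamWt y % 3 then 0
      else if x = y ∨ hamWt x % 3 = 0 then 1 else -(1 / 2) := by
  have hw := omega_sq
  have hr : (Real.sqrt 2 : ℂ)⁻¹ ^ 2 = 1 / 2 := by
    rw [inv_pow, ofReal_sqrt_sq (by norm_num)]; norm_num
  have hx (z : Fin 3 → Bool) : hamWt z = (z 0).toNat + (z 1).toNat + (z 2).toNat := by
    revert z; decide
  have hxy : x = y ↔ x 0 = y 0 ∧ x 1 = y 1 ∧ x 2 = y 2 := by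
    simp [funext_iff, Fin.forall_fin_succ]
  simp only [hx, hxy]
  simp only [ψ_apply, map_mul, Fin.sum_univ_five]
  cases x 0 <;> cases x 1 <;> cases x 2 <;> cases y 0 <;> cases y 1 <;> cases y 2 <;>
    simp [finalState, conj_omega] <;>
    generalize (Real.sqrt 2 : ℂ)⁻¹ = r at hr <;> grind

/-- Structure of the Gram matrix of the final states: states with different
Hamming weight mod 3 are orthogonal; each state is a unit vector;
`ψ(000) = ψ(111)`; and distinct states with the same weight mod 3 and
weights in `{1, 2}` have inner product `-1/2`. -/
theorem stmt_14 :
    (∀ x y : Fin 3 → Bool, hamWt x % 3 ≠ hamWt y % 3 →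
      ∑ j : Fin 5, (starRingEnd ℂ) (ψ x j) * ψ y j = 0) ∧
    (∀ x : Fin 3 → Bool, ∑ j : Fin 5, (starRingEnd ℂ) (ψ x j) * ψ x j = 1) ∧
    (ψ (fun _ => false) = ψ (fun _ => true)) ∧
    (∀ x y : Fin 3 → Bool, x ≠ y → hamWt x % 3 = hamWt y % 3 →
      (hamWt x = 1 ∨ hamWt x = 2) → (hamWt y = 1 ∨ hamWt y = 2) →
      ∑ j : Fin 5, (starRingEnd ℂ) (ψ x j) * ψ y j = -(1/2)) := by
  refine ⟨fun x y h ↦ by rw [sum_conj_ψ_mul_ψ, if_pos h], fun x ↦ by simp [sum_conj_ψ_mul_ψ],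
    by ext j; simp [ψ_apply, finalState], fun x y hne h hx _ ↦ ?_⟩
  have h0 : hamWt x % 3 ≠ 0 := by omega
  simp [sum_conj_ψ_mul_ψ, h, hne, h ▸ h0]
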